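/- Let k be a field of characteristic zero, (A, ∗, ∘, ϑ, θ) a finite-dimensional pre-Poisson bialgebra and (B, ⋄, ω) a quadratic perm algebra over k. Let · and [−,−] be the induced product and bracket on A ⊗ B, and define Δ(a ⊗ b) = (id ⊗ id + τ)(ϑ(a) • ν_ω(b)) and δ(a ⊗ b) = (id ⊗ id − τ)(θ(a) • ν_ω(b)). Then (A ⊗ B, ·, [−,−], Δ, δ) is a Poisson bialgebra. -/

import Mathlib

open TensorProduct

noncomputable section

def IsZinbiel {k A : Type} [Field k] [AddCommGroup A] [Module k A]
    (ast : A →ₗ[k] A →ₗ[k] A) : Prop :=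
  ∀ a₁ a₂ a₃ : A, ast a₁ (ast a₂ a₃) = ast (ast a₁ a₂) a₃ + ast (ast a₂ a₁) a₃

def IsPreLie {k A : Type} [Field k] [AddCommGroup A] [Module k A]
    (circ : A →ₗ[k] A →ₗ[k] A) : Prop :=
  ∀ a₁ a₂ a₃ : A,
    circ (circ a₁ a₂) a₃ - circ a₁ (circ a₂ a₃)
      = circ (circ a₂ a₁) a₃ - circ a₂ (circ a₁ a₃)

def IsPerm {k B : Type} [Field k] [AddCommGroup B] [Module k B]
    (dia : B →ₗ[k] B →ₗ[k] B) : Prop :=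
  ∀ b₁ b₂ b₃ : B,
    dia b₁ (dia b₂ b₃) = dia (dia b₁ b₂) b₃ ∧
    dia (dia b₁ b₂) b₃ = dia (dia b₂ b₁) b₃

def IsPrePoisson {k A : Type} [Field k] [AddCommGroup A] [Module k A]
    (ast circ : A →ₗ[k] A →ₗ[k] A) : Prop :=
  IsZinbiel ast ∧ IsPreLie circ ∧
  (∀ a₁ a₂ a₃ : A,
    ast (circ a₁ a₂ - circ a₂ a₁) a₃ = circ a₁ (ast a₂ a₃) - ast a₂ (circ a₁ a₃)) ∧
  (∀ a₁ a₂ a₃ : A,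
    circ (ast a₁ a₂ + ast a₂ a₁) a₃ = ast a₁ (circ a₂ a₃) + ast a₂ (circ a₁ a₃))

def IsPoisson {k P : Type} [Field k] [AddCommGroup P] [Module k P]
    (mul br : P →ₗ[k] P →ₗ[k] P) : Prop :=
  (∀ u v : P, mul u v = mul v u) ∧
  (∀ u v w : P, mul (mul u v) w = mul u (mul v w)) ∧
  (∀ u v : P, br u v = - br v u) ∧
  (∀ u v w : P, br (br u v) w + br (br v w) u + br (br w u) v = 0) ∧
  (∀ u v w : P, br u (mul v w) = mul (br u v) w + mul v (br u w))

def idm (k M : Type) [Field k] [AddCommGroup M] [Module k M] : M →ₗ[k] M :=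
  LinearMap.id

def tau (k M : Type) [Field k] [AddCommGroup M] [Module k M] :
    M ⊗[k] M →ₗ[k] M ⊗[k] M :=
  (TensorProduct.comm k M M).toLinearMap

def unassoc (k M : Type) [Field k] [AddCommGroup M] [Module k M] :
    M ⊗[k] (M ⊗[k] M) →ₗ[k] (M ⊗[k] M) ⊗[k] M :=
  (TensorProduct.assoc k M M M).symm.toLinearMap

def intch (k A B : Type) [Field k] [AddCommGroup A] [Module k A]
    [AddCommGroup B] [Module k B] :
    (A ⊗[k] A) ⊗[k] (B ⊗[k] B) →ₗ[k] (A ⊗[k] B) ⊗[k] (A ⊗[k] B) :=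
  (TensorProduct.tensorTensorTensorComm k A A B B).toLinearMap

def IsZinbielCo {k A : Type} [Field k] [AddCommGroup A] [Module k A]
    (ϑ : A →ₗ[k] A ⊗[k] A) : Prop :=
  ∀ a : A,
    TensorProduct.map ϑ (idm k A) (ϑ a)
      + TensorProduct.map (tau k A) (idm k A) (TensorProduct.map ϑ (idm k A) (ϑ a))
    = unassoc k A (TensorProduct.map (idm k A) ϑ (ϑ a))

def IsPermCo {k B : Type} [Field k] [AddCommGroup B] [Module k B]
    (ν : B →ₗ[k] B ⊗[k] B) : Prop :=
  ∀ b : B,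
    TensorProduct.map ν (idm k B) (ν b)
      = unassoc k B (TensorProduct.map (idm k B) ν (ν b)) ∧
    TensorProduct.map ν (idm k B) (ν b)
      = TensorProduct.map (tau k B) (idm k B) (TensorProduct.map ν (idm k B) (ν b))

def IsPreLieCo {k A : Type} [Field k] [AddCommGroup A] [Module k A]
    (θ : A →ₗ[k] A ⊗[k] A) : Prop :=
  ∀ a : A,
    unassoc k A (TensorProduct.map (idm k A) θ (θ a))
      - TensorProduct.map (tau k A) (idm k A)
          (unassoc k A (TensorProduct.map (idm k A) θ (θ a)))
    = TensorProduct.map θ (idm k A) (θ a)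
      - TensorProduct.map (tau k A) (idm k A) (TensorProduct.map θ (idm k A) (θ a))

def Zexp {k A : Type} [Field k] [AddCommGroup A] [Module k A]
    (ast : A →ₗ[k] A →ₗ[k] A) {p : ℕ} (x y : Fin p → A) : (A ⊗[k] A) ⊗[k] A :=
  ∑ i : Fin p, ∑ j : Fin p,
    (((ast (x i) (x j)) ⊗ₜ[k] (y j)) ⊗ₜ[k] (y i)
      + ((y j) ⊗ₜ[k] (ast (x i) (x j))) ⊗ₜ[k] (y i)
      + ((x i) ⊗ₜ[k] (x j)) ⊗ₜ[k] (ast (y i) (y j))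
      + ((x j) ⊗ₜ[k] (x i)) ⊗ₜ[k] (ast (y i) (y j))
      - ((x i) ⊗ₜ[k] (ast (y i) (x j))) ⊗ₜ[k] (y j)
      - ((x j) ⊗ₜ[k] (ast (x i) (y j))) ⊗ₜ[k] (y i)
      - ((ast (x i) (y j)) ⊗ₜ[k] (x j)) ⊗ₜ[k] (y i)
      - ((ast (y i) (x j)) ⊗ₜ[k] (x i)) ⊗ₜ[k] (y j))

def PLexp {k A : Type} [Field k] [AddCommGroup A] [Module k A]
    (circ : A →ₗ[k] A →ₗ[k] A) {p : ℕ} (x y : Fin p → A) : (A ⊗[k] A) ⊗[k] A :=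
  ∑ i : Fin p, ∑ j : Fin p,
    (((circ (x i) (x j)) ⊗ₜ[k] (y j)) ⊗ₜ[k] (y i)
      + ((x j) ⊗ₜ[k] (circ (x i) (y j))) ⊗ₜ[k] (y i)
      + ((circ (y i) (x j)) ⊗ₜ[k] (x i)) ⊗ₜ[k] (y j)
      + ((x j) ⊗ₜ[k] (x i)) ⊗ₜ[k] (circ (y i) (y j))
      - ((y j) ⊗ₜ[k] (circ (x i) (x j))) ⊗ₜ[k] (y i)
      - ((x i) ⊗ₜ[k] (circ (y i) (x j))) ⊗ₜ[k] (y j)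
      - ((circ (x i) (y j)) ⊗ₜ[k] (x j)) ⊗ₜ[k] (y i)
      - ((x i) ⊗ₜ[k] (x j)) ⊗ₜ[k] (circ (y i) (y j)))

def AYexp {k P : Type} [Field k] [AddCommGroup P] [Module k P]
    (m : P →ₗ[k] P →ₗ[k] P) {ι : Type} [Fintype ι] (u v : ι → P) :
    (P ⊗[k] P) ⊗[k] P :=
  ∑ α : ι, ∑ β : ι,
    (((m (u α) (u β)) ⊗ₜ[k] (v α)) ⊗ₜ[k] (v β)
      + ((u α) ⊗ₜ[k] (m (v α) (u β))) ⊗ₜ[k] (v β)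
      - ((u β) ⊗ₜ[k] (u α)) ⊗ₜ[k] (m (v α) (v β)))

def CYexp {k P : Type} [Field k] [AddCommGroup P] [Module k P]
    (br : P →ₗ[k] P →ₗ[k] P) {ι : Type} [Fintype ι] (u v : ι → P) :
    (P ⊗[k] P) ⊗[k] P :=
  ∑ α : ι, ∑ β : ι,
    (((br (u α) (u β)) ⊗ₜ[k] (v α)) ⊗ₜ[k] (v β)
      + ((u α) ⊗ₜ[k] (u β)) ⊗ₜ[k] (br (v α) (v β))
      + ((u α) ⊗ₜ[k] (br (v α) (u β))) ⊗ₜ[k] (v β))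

def sharp (k : Type) [Field k] {V : Type} [AddCommGroup V] [Module k V]
    (s : V ⊗[k] V) (ξ : V →ₗ[k] k) : V :=
  TensorProduct.lid k V (LinearMap.rTensor V ξ s)

abbrev PermB (k : Type) [Field k] : Type := ((ℤ × ℤ) × Fin 2) →₀ k

def bB (k : Type) [Field k] (i₁ i₂ : ℤ) (s : Fin 2) : PermB k :=
  Finsupp.single ((i₁, i₂), s) 1

section TensorBookkeeping

variable {k A B M : Type} [Field k] [AddCommGroup A] [Module k A]
  [AddCommGroup B] [Module k B] [AddCommGroup M] [Module k M]

/-- The bilinear map `Φ, Ψ ↦ Φ • Ψ`. -/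
def inter (k A B : Type) [Field k] [AddCommGroup A] [Module k A]
    [AddCommGroup B] [Module k B] :
    A ⊗[k] A →ₗ[k] B ⊗[k] B →ₗ[k] (A ⊗[k] B) ⊗[k] (A ⊗[k] B) :=
  TensorProduct.curry (intch k A B)

/-- The analogue of `inter` for threefold tensors. -/
def inter₃ (k A B : Type) [Field k] [AddCommGroup A] [Module k A]
    [AddCommGroup B] [Module k B] :
    (A ⊗[k] A) ⊗[k] A →ₗ[k] (B ⊗[k] B) ⊗[k] B →ₗ[k]
      ((A ⊗[k] B) ⊗[k] (A ⊗[k] B)) ⊗[k] (A ⊗[k] B) :=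
  TensorProduct.curry
    (TensorProduct.map (intch k A B) (idm k (A ⊗[k] B)) ∘ₗ
      (TensorProduct.tensorTensorTensorComm k (A ⊗[k] A) A (B ⊗[k] B) B).toLinearMap)

/-- The cyclic permutation `x ⊗ y ⊗ z ↦ z ⊗ x ⊗ y`. -/
def cyc (k M : Type) [Field k] [AddCommGroup M] [Module k M] :
    (M ⊗[k] M) ⊗[k] M →ₗ[k] (M ⊗[k] M) ⊗[k] M :=
  unassoc k M ∘ₗ (TensorProduct.comm k (M ⊗[k] M) M).toLinearMap

/-- The cyclic permutation `x ⊗ y ⊗ z ↦ y ⊗ z ⊗ x`. -/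
def cycInv (k M : Type) [Field k] [AddCommGroup M] [Module k M] :
    (M ⊗[k] M) ⊗[k] M →ₗ[k] (M ⊗[k] M) ⊗[k] M :=
  (TensorProduct.comm k M (M ⊗[k] M)).toLinearMap ∘ₗ
    (TensorProduct.assoc k M M M).toLinearMap

/-- The transposition `x ⊗ y ⊗ z ↦ y ⊗ x ⊗ z`. -/
def swap₁₂ (k M : Type) [Field k] [AddCommGroup M] [Module k M] :
    (M ⊗[k] M) ⊗[k] M →ₗ[k] (M ⊗[k] M) ⊗[k] M :=
  TensorProduct.map (tau k M) (idm k M)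

lemma swap₁₂_def (x : (M ⊗[k] M) ⊗[k] M) :
    TensorProduct.map (tau k M) (idm k M) x = swap₁₂ k M x := rfl

@[simp] lemma idm_apply (x : M) : idm k M x = x := rfl

@[simp] lemma tau_tmul (x y : M) : tau k M (x ⊗ₜ y) = y ⊗ₜ x := rfl

@[simp] lemma unassoc_tmul (x y z : M) :
    unassoc k M (x ⊗ₜ (y ⊗ₜ z)) = (x ⊗ₜ y) ⊗ₜ z := rfl

@[simp] lemma cyc_tmul (x y z : M) : cyc k M ((x ⊗ₜ y) ⊗ₜ z) = (z ⊗ₜ x) ⊗ₜ y := rfl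

@[simp] lemma cycInv_tmul (x y z : M) :
    cycInv k M ((x ⊗ₜ y) ⊗ₜ z) = (y ⊗ₜ z) ⊗ₜ x := rfl

@[simp] lemma swap₁₂_tmul (w : M ⊗[k] M) (z : M) :
    swap₁₂ k M (w ⊗ₜ z) = tau k M w ⊗ₜ z := rfl

@[simp] lemma inter_tmul (a a' : A) (b b' : B) :
    inter k A B (a ⊗ₜ a') (b ⊗ₜ b') = (a ⊗ₜ b) ⊗ₜ (a' ⊗ₜ b') := rfl

@[simp] lemma inter₃_tmul (X : A ⊗[k] A) (a : A) (Y : B ⊗[k] B) (b : B) :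
    inter₃ k A B (X ⊗ₜ a) (Y ⊗ₜ b) = inter k A B X Y ⊗ₜ (a ⊗ₜ b) := rfl

@[simp] lemma tau_tau (x : M ⊗[k] M) : tau k M (tau k M x) = x :=
  (TensorProduct.comm k M M).symm_apply_apply x

lemma tau_map (f g : M →ₗ[k] M) (x : M ⊗[k] M) :
    tau k M (TensorProduct.map f g x) = TensorProduct.map g f (tau k M x) := by
  induction x with
  | zero => simp
  | tmul a b => rfl
  | add x y hx hy => simp [hx, hy]

lemma tau_inter (X : A ⊗[k] A) (Y : B ⊗[k] B) :
    tau k (A ⊗[k] B) (inter k A B X Y) = inter k A B (tau k A X) (tau k B Y) := by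
  have : (inter k A B).compr₂ (tau k (A ⊗[k] B))
      = (inter k A B).compl₁₂ (tau k A) (tau k B) := by
    ext; rfl
  exact LinearMap.congr_fun₂ this X Y

lemma tensor₃_map_ext {N : Type} [AddCommGroup N] [Module k N]
    {f g : (M ⊗[k] M) ⊗[k] M →ₗ[k] N}
    (h : ∀ x y z, f ((x ⊗ₜ y) ⊗ₜ z) = g ((x ⊗ₜ y) ⊗ₜ z)) (t : (M ⊗[k] M) ⊗[k] M) :
    f t = g t :=
  LinearMap.congr_fun (TensorProduct.ext_threefold h) t

@[simp] lemma swap₁₂_swap₁₂ (t : (M ⊗[k] M) ⊗[k] M) :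
    swap₁₂ k M (swap₁₂ k M t) = t :=
  tensor₃_map_ext (f := swap₁₂ k M ∘ₗ swap₁₂ k M) (g := LinearMap.id)
    (fun _ _ _ => rfl) t

@[simp] lemma swap₁₂_cyc (t : (M ⊗[k] M) ⊗[k] M) :
    swap₁₂ k M (cyc k M t) = cycInv k M (swap₁₂ k M t) :=
  tensor₃_map_ext (f := swap₁₂ k M ∘ₗ cyc k M) (g := cycInv k M ∘ₗ swap₁₂ k M)
    (fun _ _ _ => rfl) t

@[simp] lemma swap₁₂_cycInv (t : (M ⊗[k] M) ⊗[k] M) :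
    swap₁₂ k M (cycInv k M t) = cyc k M (swap₁₂ k M t) :=
  tensor₃_map_ext (f := swap₁₂ k M ∘ₗ cycInv k M) (g := cyc k M ∘ₗ swap₁₂ k M)
    (fun _ _ _ => rfl) t

@[simp] lemma cyc_cyc (t : (M ⊗[k] M) ⊗[k] M) :
    cyc k M (cyc k M t) = cycInv k M t :=
  tensor₃_map_ext (f := cyc k M ∘ₗ cyc k M) (g := cycInv k M) (fun _ _ _ => rfl) t

@[simp] lemma cyc_cycInv (t : (M ⊗[k] M) ⊗[k] M) :
    cyc k M (cycInv k M t) = t :=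
  tensor₃_map_ext (f := cyc k M ∘ₗ cycInv k M) (g := LinearMap.id) (fun _ _ _ => rfl) t

lemma swap₁₂_inter₃ (X : (A ⊗[k] A) ⊗[k] A) (Y : (B ⊗[k] B) ⊗[k] B) :
    swap₁₂ k (A ⊗[k] B) (inter₃ k A B X Y)
      = inter₃ k A B (swap₁₂ k A X) (swap₁₂ k B Y) := by
  have : (inter₃ k A B).compr₂ (swap₁₂ k (A ⊗[k] B))
      = (inter₃ k A B).compl₁₂ (swap₁₂ k A) (swap₁₂ k B) := by
    ext; rfl
  exact LinearMap.congr_fun₂ this X Y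

lemma map_id_tau (f : M →ₗ[k] M ⊗[k] M) (x : M ⊗[k] M) :
    TensorProduct.map f (idm k M) (tau k M x)
      = cycInv k M (unassoc k M (TensorProduct.map (idm k M) f x)) := by
  induction x with
  | zero => simp
  | tmul a b =>
    simp only [tau_tmul, TensorProduct.map_tmul, idm_apply]
    generalize f b = w
    induction w with
    | zero => simp
    | tmul a b => rfl
    | add x y hx hy => simp [TensorProduct.tmul_add, TensorProduct.add_tmul, hx, hy]
  | add x y hx hy => simp [hx, hy]

lemma unassoc_id_map_tau (f : M →ₗ[k] M ⊗[k] M) (x : M ⊗[k] M) :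
    unassoc k M (TensorProduct.map (idm k M) f (tau k M x))
      = cyc k M (TensorProduct.map f (idm k M) x) := by
  rw [← tau_tau x, map_id_tau, cyc_cycInv, tau_tau]

lemma map_eq_inter₃ {f : A →ₗ[k] A ⊗[k] A} {g : B →ₗ[k] B ⊗[k] B} {ε : k}
    {D : A ⊗[k] B →ₗ[k] (A ⊗[k] B) ⊗[k] (A ⊗[k] B)}
    (hD : ∀ a b, D (a ⊗ₜ b)
      = inter k A B (f a) (g b) + ε • inter k A B (tau k A (f a)) (tau k B (g b)))
    (X : A ⊗[k] A) (Y : B ⊗[k] B) :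
    TensorProduct.map D (idm k (A ⊗[k] B)) (inter k A B X Y)
      = inter₃ k A B (TensorProduct.map f (idm k A) X) (TensorProduct.map g (idm k B) Y)
        + ε • inter₃ k A B (swap₁₂ k A (TensorProduct.map f (idm k A) X))
            (swap₁₂ k B (TensorProduct.map g (idm k B) Y)) := by
  have : (inter k A B).compr₂ (TensorProduct.map D (idm k (A ⊗[k] B)))
      = (inter₃ k A B).compl₁₂ (TensorProduct.map f (idm k A)) (TensorProduct.map g (idm k B))
        + ε • (inter₃ k A B).compl₁₂ (swap₁₂ k A ∘ₗ TensorProduct.map f (idm k A))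
            (swap₁₂ k B ∘ₗ TensorProduct.map g (idm k B)) := by
    ext a a' b b'
    simp [hD, TensorProduct.add_tmul, TensorProduct.smul_tmul']
  exact LinearMap.congr_fun₂ this X Y

lemma unassoc_tmul_inter (a : A) (b : B) (X : A ⊗[k] A) (Y : B ⊗[k] B) :
    unassoc k (A ⊗[k] B) ((a ⊗ₜ b) ⊗ₜ inter k A B X Y)
      = inter₃ k A B (unassoc k A (a ⊗ₜ X)) (unassoc k B (b ⊗ₜ Y)) := by
  have : (inter k A B).compr₂ (unassoc k (A ⊗[k] B) ∘ₗ TensorProduct.mk k _ _ (a ⊗ₜ b))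
      = (inter₃ k A B).compl₁₂ (unassoc k A ∘ₗ TensorProduct.mk k _ _ a)
          (unassoc k B ∘ₗ TensorProduct.mk k _ _ b) := by
    ext; rfl
  exact LinearMap.congr_fun₂ this X Y

lemma unassoc_tmul_tau (a : M) (x : M ⊗[k] M) :
    unassoc k M (a ⊗ₜ tau k M x) = swap₁₂ k M (cyc k M (unassoc k M (a ⊗ₜ x))) := by
  induction x with
  | zero => simp
  | tmul a b => rfl
  | add x y hx hy => simp only [map_add, TensorProduct.tmul_add, hx, hy]

lemma unassoc_map_eq_inter₃ {f : A →ₗ[k] A ⊗[k] A} {g : B →ₗ[k] B ⊗[k] B} {ε : k}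
    {D : A ⊗[k] B →ₗ[k] (A ⊗[k] B) ⊗[k] (A ⊗[k] B)}
    (hD : ∀ a b, D (a ⊗ₜ b)
      = inter k A B (f a) (g b) + ε • inter k A B (tau k A (f a)) (tau k B (g b)))
    (X : A ⊗[k] A) (Y : B ⊗[k] B) :
    unassoc k (A ⊗[k] B) (TensorProduct.map (idm k (A ⊗[k] B)) D (inter k A B X Y))
      = inter₃ k A B (unassoc k A (TensorProduct.map (idm k A) f X))
          (unassoc k B (TensorProduct.map (idm k B) g Y))
        + ε • inter₃ k A B
            (swap₁₂ k A (cyc k A (unassoc k A (TensorProduct.map (idm k A) f X))))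
            (swap₁₂ k B (cyc k B (unassoc k B (TensorProduct.map (idm k B) g Y)))) := by
  have : (inter k A B).compr₂
        (unassoc k (A ⊗[k] B) ∘ₗ TensorProduct.map (idm k (A ⊗[k] B)) D)
      = (inter₃ k A B).compl₁₂ (unassoc k A ∘ₗ TensorProduct.map (idm k A) f)
            (unassoc k B ∘ₗ TensorProduct.map (idm k B) g)
        + ε • (inter₃ k A B).compl₁₂
            (swap₁₂ k A ∘ₗ cyc k A ∘ₗ unassoc k A ∘ₗ TensorProduct.map (idm k A) f)
            (swap₁₂ k B ∘ₗ cyc k B ∘ₗ unassoc k B ∘ₗ TensorProduct.map (idm k B) g) := by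
    ext a a' b b'
    simp only [TensorProduct.AlgebraTensorModule.curry_apply, TensorProduct.curry_apply,
      LinearMap.restrictScalars_self, LinearMap.compr₂_apply, inter_tmul,
      LinearMap.comp_apply, TensorProduct.map_tmul, idm_apply, hD, TensorProduct.tmul_add,
      TensorProduct.tmul_smul, map_add, map_smul, unassoc_tmul_inter, unassoc_tmul_tau,
      LinearMap.add_apply, LinearMap.smul_apply, LinearMap.compl₁₂_apply]
  exact LinearMap.congr_fun₂ this X Y

lemma map_left_inter {D : A ⊗[k] B →ₗ[k] A ⊗[k] B} {f f' : A →ₗ[k] A} {g g' : B →ₗ[k] B}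
    {ε : k} (hD : ∀ a b, D (a ⊗ₜ b) = f a ⊗ₜ g b + ε • f' a ⊗ₜ g' b)
    (X : A ⊗[k] A) (Y : B ⊗[k] B) :
    TensorProduct.map D (idm k (A ⊗[k] B)) (inter k A B X Y)
      = inter k A B (TensorProduct.map f (idm k A) X) (TensorProduct.map g (idm k B) Y)
        + ε • inter k A B (TensorProduct.map f' (idm k A) X)
            (TensorProduct.map g' (idm k B) Y) := by
  have : (inter k A B).compr₂ (TensorProduct.map D (idm k (A ⊗[k] B)))
      = (inter k A B).compl₁₂ (TensorProduct.map f (idm k A)) (TensorProduct.map g (idm k B))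
        + ε • (inter k A B).compl₁₂ (TensorProduct.map f' (idm k A))
            (TensorProduct.map g' (idm k B)) := by
    ext a a' b b'
    simp [hD, TensorProduct.add_tmul, TensorProduct.smul_tmul']
  exact LinearMap.congr_fun₂ this X Y

lemma map_right_inter {D : A ⊗[k] B →ₗ[k] A ⊗[k] B} {f f' : A →ₗ[k] A} {g g' : B →ₗ[k] B}
    {ε : k} (hD : ∀ a b, D (a ⊗ₜ b) = f a ⊗ₜ g b + ε • f' a ⊗ₜ g' b)
    (X : A ⊗[k] A) (Y : B ⊗[k] B) :
    TensorProduct.map (idm k (A ⊗[k] B)) D (inter k A B X Y)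
      = inter k A B (TensorProduct.map (idm k A) f X) (TensorProduct.map (idm k B) g Y)
        + ε • inter k A B (TensorProduct.map (idm k A) f' X)
            (TensorProduct.map (idm k B) g' Y) := by
  have : (inter k A B).compr₂ (TensorProduct.map (idm k (A ⊗[k] B)) D)
      = (inter k A B).compl₁₂ (TensorProduct.map (idm k A) f) (TensorProduct.map (idm k B) g)
        + ε • (inter k A B).compl₁₂ (TensorProduct.map (idm k A) f')
            (TensorProduct.map (idm k B) g') := by
    ext a a' b b'
    simp only [TensorProduct.AlgebraTensorModule.curry_apply, TensorProduct.curry_apply,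
      LinearMap.restrictScalars_self, LinearMap.compr₂_apply, inter_tmul,
      TensorProduct.map_tmul, idm_apply, hD, TensorProduct.tmul_add, TensorProduct.tmul_smul,
      LinearMap.add_apply, LinearMap.smul_apply, LinearMap.compl₁₂_apply]
  exact LinearMap.congr_fun₂ this X Y

lemma map_add_idm (f g : M →ₗ[k] M ⊗[k] M) (x : M ⊗[k] M) :
    TensorProduct.map (f + g) (idm k M) x
      = TensorProduct.map f (idm k M) x + TensorProduct.map g (idm k M) x := by
  rw [TensorProduct.map_add_left, LinearMap.add_apply]

lemma map_sub_idm (f g : M →ₗ[k] M ⊗[k] M) (x : M ⊗[k] M) :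
    TensorProduct.map (f - g) (idm k M) x
      = TensorProduct.map f (idm k M) x - TensorProduct.map g (idm k M) x := by
  rw [eq_sub_iff_add_eq, ← map_add_idm, sub_add_cancel]

lemma map_idm_add (f g : M →ₗ[k] M) (x : M ⊗[k] M) :
    TensorProduct.map (idm k M) (f + g) x
      = TensorProduct.map (idm k M) f x + TensorProduct.map (idm k M) g x := by
  rw [TensorProduct.map_add_right, LinearMap.add_apply]

lemma map_idm_sub (f g : M →ₗ[k] M) (x : M ⊗[k] M) :
    TensorProduct.map (idm k M) (f - g) x
      = TensorProduct.map (idm k M) f x - TensorProduct.map (idm k M) g x := by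
  rw [eq_sub_iff_add_eq, ← map_idm_add, sub_add_cancel]

lemma map_tau_comp_idm (f : M →ₗ[k] M ⊗[k] M) (x : M ⊗[k] M) :
    TensorProduct.map (tau k M ∘ₗ f) (idm k M) x
      = swap₁₂ k M (TensorProduct.map f (idm k M) x) := by
  induction x with
  | zero => simp
  | tmul a b => rfl
  | add x y hx hy => simp [hx, hy]

/-- Nondegeneracy of forms passes to tensor products. -/
lemma dualDistrib_map_injective {M N M' N' : Type} [AddCommGroup M] [Module k M]
    [AddCommGroup N] [Module k N] [AddCommGroup M'] [Module k M'] [FiniteDimensional k M']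
    [AddCommGroup N'] [Module k N'] [FiniteDimensional k N']
    {f : M →ₗ[k] Module.Dual k M'} {g : N →ₗ[k] Module.Dual k N'}
    (hf : Function.Injective f) (hg : Function.Injective g) :
    Function.Injective (TensorProduct.dualDistrib k M' N' ∘ₗ TensorProduct.map f g) := by
  rw [LinearMap.coe_comp]
  exact (TensorProduct.dualDistribEquiv k M' N').injective.comp
    (TensorProduct.map_injective_of_flat_flat f g hf hg)

end TensorBookkeeping

section QuadraticPerm

/-- A quadratic perm algebra `(B, dia, ω)` with the induced form `ωh` on `B ⊗ B` and the
induced coproduct `ν`. -/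
structure IsQuadraticPerm {k B : Type} [Field k] [AddCommGroup B] [Module k B]
    (dia : B →ₗ[k] B →ₗ[k] B) (ω : B →ₗ[k] B →ₗ[k] k)
    (ωh : B ⊗[k] B →ₗ[k] B ⊗[k] B →ₗ[k] k) (ν : B →ₗ[k] B ⊗[k] B) : Prop where
  perm : IsPerm dia
  antisymm : ∀ b₁ b₂, ω b₁ b₂ = - ω b₂ b₁
  nondeg : ∀ b₁, (∀ b₂, ω b₁ b₂ = 0) → b₁ = 0
  invariant : ∀ b₁ b₂ b₃, ω (dia b₁ b₂) b₃ = ω b₁ (dia b₂ b₃ - dia b₃ b₂)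
  form₂ : ∀ u₁ u₂ v₁ v₂, ωh (u₁ ⊗ₜ u₂) (v₁ ⊗ₜ v₂) = ω u₁ v₁ * ω u₂ v₂
  coproduct : ∀ b₁ b₂ b₃, ωh (ν b₁) (b₂ ⊗ₜ b₃) = - ω b₁ (dia b₂ b₃)

namespace IsQuadraticPerm

variable {k B : Type} [Field k] [AddCommGroup B] [Module k B]
  {dia : B →ₗ[k] B →ₗ[k] B} {ω : B →ₗ[k] B →ₗ[k] k}
  {ωh : B ⊗[k] B →ₗ[k] B ⊗[k] B →ₗ[k] k} {ν : B →ₗ[k] B ⊗[k] B}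

lemma form_dia_left (h : IsQuadraticPerm dia ω ωh ν) (a b c : B) :
    ω (dia a b) c = ω b (dia a c) := by
  rw [h.invariant, ← neg_sub, map_neg, ← h.invariant, ← h.antisymm]

lemma form_dia_right (h : IsQuadraticPerm dia ω ωh ν) (a b c : B) :
    ω (dia.flip b a) c = ω a ((dia b - dia.flip b) c) :=
  h.invariant a b c

lemma form₂_map_left (h : IsQuadraticPerm dia ω ωh ν) {f g : B →ₗ[k] B}
    (hfg : ∀ x y, ω (f x) y = ω x (g y)) (x : B ⊗[k] B) (d e : B) :
    ωh (TensorProduct.map f (idm k B) x) (d ⊗ₜ e) = ωh x (g d ⊗ₜ e) := by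
  induction x with
  | zero => simp
  | tmul a b => simp [h.form₂, hfg]
  | add x y hx hy => simp [hx, hy]

lemma form₂_map_right (h : IsQuadraticPerm dia ω ωh ν) {f g : B →ₗ[k] B}
    (hfg : ∀ x y, ω (f x) y = ω x (g y)) (x : B ⊗[k] B) (d e : B) :
    ωh (TensorProduct.map (idm k B) f x) (d ⊗ₜ e) = ωh x (d ⊗ₜ g e) := by
  induction x with
  | zero => simp
  | tmul a b => simp [h.form₂, hfg]
  | add x y hx hy => simp [hx, hy]

lemma form₂_tau (h : IsQuadraticPerm dia ω ωh ν) (x : B ⊗[k] B) (d e : B) :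
    ωh (tau k B x) (d ⊗ₜ e) = ωh x (e ⊗ₜ d) := by
  induction x with
  | zero => simp
  | tmul a b => simp [h.form₂, mul_comm]
  | add x y hx hy => simp [hx, hy]

lemma form_injective (h : IsQuadraticPerm dia ω ωh ν) : Function.Injective ω :=
  (injective_iff_map_eq_zero ω).2 fun b hb => h.nondeg b fun c => by rw [hb]; rfl

lemma dia_swap (h : IsQuadraticPerm dia ω ωh ν) (a b c : B) :
    dia a (dia b c) = dia b (dia a c) := by
  rw [(h.perm a b c).1, (h.perm a b c).2, (h.perm b a c).1]

/-- The form on threefold tensors. -/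
def form₃ {k B : Type} [Field k] [AddCommGroup B] [Module k B]
    (ω : B →ₗ[k] B →ₗ[k] k) (ωh : B ⊗[k] B →ₗ[k] B ⊗[k] B →ₗ[k] k) :
    (B ⊗[k] B) ⊗[k] B →ₗ[k] Module.Dual k ((B ⊗[k] B) ⊗[k] B) :=
  TensorProduct.dualDistrib k (B ⊗[k] B) B ∘ₗ TensorProduct.map ωh ω

@[simp] lemma form₃_tmul (x y : B ⊗[k] B) (b c : B) :
    form₃ ω ωh (x ⊗ₜ b) (y ⊗ₜ c) = ωh x y * ω b c := rfl

lemma form₃_map_coproduct (h : IsQuadraticPerm dia ω ωh ν) (x : B ⊗[k] B) (c d e : B) :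
    form₃ ω ωh (TensorProduct.map ν (idm k B) x) ((c ⊗ₜ d) ⊗ₜ e)
      = - ωh x (dia c d ⊗ₜ e) := by
  induction x with
  | zero => simp
  | tmul a b => simp [h.form₂, h.coproduct]
  | add x y hx hy => simp only [map_add, LinearMap.add_apply, hx, hy, neg_add]

lemma form₃_unassoc (h : IsQuadraticPerm dia ω ωh ν) (b : B) (x : B ⊗[k] B) (c d e : B) :
    form₃ ω ωh (unassoc k B (b ⊗ₜ x)) ((c ⊗ₜ d) ⊗ₜ e) = ω b c * ωh x (d ⊗ₜ e) := by
  induction x with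
  | zero => simp
  | tmul a b => simp [h.form₂, mul_assoc]
  | add x y hx hy => simp only [map_add, TensorProduct.tmul_add, LinearMap.add_apply, hx, hy,
      mul_add]

lemma form₃_unassoc_map_coproduct (h : IsQuadraticPerm dia ω ωh ν) (x : B ⊗[k] B)
    (c d e : B) :
    form₃ ω ωh (unassoc k B (TensorProduct.map (idm k B) ν x)) ((c ⊗ₜ d) ⊗ₜ e)
      = - ωh x (c ⊗ₜ dia d e) := by
  induction x with
  | zero => simp
  | tmul a b => simp [h.form₂, h.coproduct, h.form₃_unassoc]
  | add x y hx hy => simp only [map_add, LinearMap.add_apply, hx, hy, neg_add]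

lemma form₃_swap₁₂ (h : IsQuadraticPerm dia ω ωh ν) (x : (B ⊗[k] B) ⊗[k] B) (c d e : B) :
    form₃ ω ωh (swap₁₂ k B x) ((c ⊗ₜ d) ⊗ₜ e) = form₃ ω ωh x ((d ⊗ₜ c) ⊗ₜ e) := by
  induction x with
  | zero => simp
  | tmul a b => simp [h.form₂_tau]
  | add x y hx hy => simp only [map_add, LinearMap.add_apply, hx, hy]

variable [FiniteDimensional k B]

lemma form₂_injective (h : IsQuadraticPerm dia ω ωh ν) : Function.Injective ωh := by
  have hωh : ωh = TensorProduct.dualDistrib k B B ∘ₗ TensorProduct.map ω ω := by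
    ext; simp [h.form₂]
  rw [hωh]
  exact dualDistrib_map_injective h.form_injective h.form_injective

lemma form₂_ext (h : IsQuadraticPerm dia ω ωh ν) {x y : B ⊗[k] B}
    (hxy : ∀ d e, ωh x (d ⊗ₜ e) = ωh y (d ⊗ₜ e)) : x = y := by
  apply h.form₂_injective
  ext d e
  exact hxy d e

lemma map_dia_left (h : IsQuadraticPerm dia ω ωh ν) (b c : B) :
    TensorProduct.map (dia b) (idm k B) (ν c) = ν (dia b c) :=
  h.form₂_ext fun d e => by
    rw [h.form₂_map_left (h.form_dia_left b), h.coproduct, h.coproduct, h.form_dia_left,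
      (h.perm b d e).1]

lemma map_dia_right (h : IsQuadraticPerm dia ω ωh ν) (b c : B) :
    TensorProduct.map (idm k B) (dia b) (ν c) = ν (dia b c) :=
  h.form₂_ext fun d e => by
    rw [h.form₂_map_right (h.form_dia_left b), h.coproduct, h.coproduct, h.form_dia_left,
      h.dia_swap]

lemma map_flip_left (h : IsQuadraticPerm dia ω ωh ν) (b c : B) :
    TensorProduct.map (dia.flip b) (idm k B) (ν c) = 0 :=
  h.form₂_ext fun d e => by
    rw [h.form₂_map_left fun x y => h.form_dia_right x b y, h.coproduct]
    simp [(h.perm b d e).2]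

lemma map_flip_right (h : IsQuadraticPerm dia ω ωh ν) (b c : B) :
    TensorProduct.map (idm k B) (dia.flip b) (ν c) = ν (dia c b) :=
  h.form₂_ext fun d e => by
    rw [h.form₂_map_right fun x y => h.form_dia_right x b y, h.coproduct, h.coproduct,
      h.invariant]
    simp only [LinearMap.sub_apply, LinearMap.flip_apply, map_sub]
    rw [h.dia_swap d b e, (h.perm d e b).1]

lemma tau_coproduct_dia (h : IsQuadraticPerm dia ω ωh ν) (b c : B) :
    tau k B (ν (dia b c)) = tau k B (ν (dia c b)) + ν (dia b c) - ν (dia c b) :=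
  h.form₂_ext fun d e => by
    simp only [map_sub, map_add, LinearMap.sub_apply, LinearMap.add_apply, h.form₂_tau,
      h.coproduct, h.form_dia_left c b, h.invariant b c]
    rw [← (h.perm d e c).1, ← (h.perm e d c).1, h.dia_swap e d c]
    ring

lemma form₃_ext (h : IsQuadraticPerm dia ω ωh ν) {x y : (B ⊗[k] B) ⊗[k] B}
    (hxy : ∀ c d e, form₃ ω ωh x ((c ⊗ₜ d) ⊗ₜ e) = form₃ ω ωh y ((c ⊗ₜ d) ⊗ₜ e)) :
    x = y := by
  apply (dualDistrib_map_injective h.form₂_injective h.form_injective :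
    Function.Injective (form₃ ω ωh))
  exact TensorProduct.ext_threefold hxy

lemma unassoc_map_coproduct (h : IsQuadraticPerm dia ω ωh ν) (b : B) :
    unassoc k B (TensorProduct.map (idm k B) ν (ν b))
      = TensorProduct.map ν (idm k B) (ν b) :=
  h.form₃_ext fun c d e => by
    rw [h.form₃_map_coproduct, h.form₃_unassoc_map_coproduct, h.coproduct, h.coproduct,
      (h.perm c d e).1]

lemma swap₁₂_map_coproduct (h : IsQuadraticPerm dia ω ωh ν) (b : B) :
    swap₁₂ k B (TensorProduct.map ν (idm k B) (ν b))
      = TensorProduct.map ν (idm k B) (ν b) :=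
  h.form₃_ext fun c d e => by
    rw [h.form₃_swap₁₂, h.form₃_map_coproduct, h.form₃_map_coproduct, h.coproduct,
      h.coproduct, (h.perm c d e).2]

end IsQuadraticPerm

end QuadraticPerm

section InducedStructure

variable {k A B : Type} [Field k] [AddCommGroup A] [Module k A] [AddCommGroup B] [Module k B]

lemma tmul_congr_left {A B : Type} (k : Type) [Field k] [AddCommGroup A] [Module k A]
    [AddCommGroup B] [Module k B] {x y : A} (h : x = y) (b : B) :
    x ⊗ₜ[k] b = y ⊗ₜ b := by rw [h]

lemma tensor_induction₂ {p : A ⊗[k] B → A ⊗[k] B → Prop} (zero_left : ∀ v, p 0 v)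
    (zero_right : ∀ u, p u 0) (add_left : ∀ u u' v, p u v → p u' v → p (u + u') v)
    (add_right : ∀ u v v', p u v → p u v' → p u (v + v'))
    (tmul : ∀ a a' b b', p (a ⊗ₜ b) (a' ⊗ₜ b')) (u v : A ⊗[k] B) : p u v := by
  induction u with
  | zero => exact zero_left v
  | add x y hx hy => exact add_left x y v hx hy
  | tmul a b =>
    induction v with
    | zero => exact zero_right _
    | add x y hx hy => exact add_right _ x y hx hy
    | tmul a' b' => exact tmul a a' b b'

theorem isPoisson_tensor {ast circ : A →ₗ[k] A →ₗ[k] A} (hA : IsPrePoisson ast circ)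
    {dia : B →ₗ[k] B →ₗ[k] B} (hdia : IsPerm dia)
    {m br : A ⊗[k] B →ₗ[k] A ⊗[k] B →ₗ[k] A ⊗[k] B}
    (hm : ∀ (a₁ a₂ : A) (b₁ b₂ : B),
      m (a₁ ⊗ₜ[k] b₁) (a₂ ⊗ₜ[k] b₂)
        = (ast a₁ a₂) ⊗ₜ[k] (dia b₁ b₂) + (ast a₂ a₁) ⊗ₜ[k] (dia b₂ b₁))
    (hbr : ∀ (a₁ a₂ : A) (b₁ b₂ : B),
      br (a₁ ⊗ₜ[k] b₁) (a₂ ⊗ₜ[k] b₂)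
        = (circ a₁ a₂) ⊗ₜ[k] (dia b₁ b₂) - (circ a₂ a₁) ⊗ₜ[k] (dia b₂ b₁)) :
    IsPoisson m br := by
  obtain ⟨hZ, hPL, hP₁, hP₂⟩ := hA
  have dia_assoc (a b c : B) : dia a (dia b c) = dia (dia a b) c := (hdia a b c).1
  have dia_comm (a b c : B) : dia (dia a b) c = dia (dia b a) c := (hdia a b c).2
  refine ⟨fun u v => ?_, fun u v w => ?_, fun u v => ?_, fun u v w => ?_, fun u v w => ?_⟩
  · have : m = m.flip := by
      ext a b a' b'
      simp [hm, add_comm]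
    exact LinearMap.congr_fun₂ this u v
  · induction u with
    | zero => simp
    | add x y hx hy => simp only [map_add, LinearMap.add_apply, hx, hy]
    | tmul a₁ b₁ =>
    induction v with
    | zero => simp
    | add x y hx hy => simp only [map_add, LinearMap.add_apply, hx, hy]
    | tmul a₂ b₂ =>
    induction w with
    | zero => simp
    | add x y hx hy => simp only [map_add, hx, hy]
    | tmul a₃ b₃ =>
    simp only [hm, map_add, LinearMap.add_apply, dia_assoc, dia_comm b₂ b₁ b₃,
      dia_comm b₃ b₁ b₂, dia_comm b₃ b₂ b₁]
    linear_combination (norm := (simp only [TensorProduct.add_tmul]; abel))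
      tmul_congr_left k (hZ a₃ a₁ a₂) (dia (dia b₁ b₃) b₂)
        - tmul_congr_left k (hZ a₁ a₃ a₂) (dia (dia b₁ b₃) b₂)
        - tmul_congr_left k (hZ a₁ a₂ a₃) (dia (dia b₁ b₂) b₃)
        + tmul_congr_left k (hZ a₃ a₂ a₁) (dia (dia b₂ b₃) b₁)
  · have : br = -br.flip := by
      ext a b a' b'
      simp [hbr]
    exact LinearMap.congr_fun₂ this u v
  · induction u with
    | zero => simp
    | add x y hx hy =>
      linear_combination (norm := (simp only [map_add, LinearMap.add_apply]; abel)) hx + hy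
    | tmul a₁ b₁ =>
    induction v with
    | zero => simp
    | add x y hx hy =>
      linear_combination (norm := (simp only [map_add, LinearMap.add_apply]; abel)) hx + hy
    | tmul a₂ b₂ =>
    induction w with
    | zero => simp
    | add x y hx hy =>
      linear_combination (norm := (simp only [map_add, LinearMap.add_apply]; abel)) hx + hy
    | tmul a₃ b₃ =>
    simp only [hbr, map_sub, LinearMap.sub_apply, dia_assoc, dia_comm b₂ b₁ b₃,
      dia_comm b₃ b₁ b₂, dia_comm b₃ b₂ b₁]
    linear_combination (norm := (simp only [TensorProduct.sub_tmul]; abel))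
      tmul_congr_left k (hPL a₁ a₂ a₃) (dia (dia b₁ b₂) b₃)
        + tmul_congr_left k (hPL a₂ a₃ a₁) (dia (dia b₂ b₃) b₁)
        + tmul_congr_left k (hPL a₃ a₁ a₂) (dia (dia b₁ b₃) b₂)
  · induction u with
    | zero => simp
    | add x y hx hy =>
      linear_combination (norm := (simp only [map_add, LinearMap.add_apply]; abel)) hx + hy
    | tmul a₁ b₁ =>
    induction v with
    | zero => simp
    | add x y hx hy =>
      linear_combination (norm := (simp only [map_add, LinearMap.add_apply]; abel)) hx + hy
    | tmul a₂ b₂ =>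
    induction w with
    | zero => simp
    | add x y hx hy =>
      linear_combination (norm := (simp only [map_add]; abel)) hx + hy
    | tmul a₃ b₃ =>
    simp only [hbr, hm, map_sub, map_add, LinearMap.sub_apply, dia_assoc,
      dia_comm b₂ b₁ b₃, dia_comm b₃ b₁ b₂, dia_comm b₃ b₂ b₁]
    linear_combination (norm := (simp only [map_sub, map_add, LinearMap.sub_apply,
        LinearMap.add_apply, TensorProduct.sub_tmul, TensorProduct.add_tmul]; abel))
      - tmul_congr_left k (hP₁ a₁ a₂ a₃) (dia (dia b₁ b₂) b₃)
        - tmul_congr_left k (hP₁ a₁ a₃ a₂) (dia (dia b₁ b₃) b₂)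
        - tmul_congr_left k (hP₂ a₂ a₃ a₁) (dia (dia b₂ b₃) b₁)

lemma inter_congr_left {X X' : A ⊗[k] A} (h : X = X') (Y : B ⊗[k] B) :
    inter k A B X Y = inter k A B X' Y := by rw [h]

lemma inter₃_congr_left {X X' : (A ⊗[k] A) ⊗[k] A} (h : X = X') (Y : (B ⊗[k] B) ⊗[k] B) :
    inter₃ k A B X Y = inter₃ k A B X' Y := by rw [h]

lemma neg_one_smul_tensor {M N : Type} [AddCommGroup M] [Module k M] [AddCommGroup N]
    [Module k N] (x : M ⊗[k] N) : (-1 : k) • x = -x :=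
  neg_one_smul k x

lemma neg_one_smul_tensor₂ (x : (A ⊗[k] B) ⊗[k] (A ⊗[k] B)) : (-1 : k) • x = -x :=
  neg_one_smul k x

set_option maxSynthPendingDepth 5 in
lemma neg_one_smul_tensor₃ (x : ((A ⊗[k] B) ⊗[k] (A ⊗[k] B)) ⊗[k] (A ⊗[k] B)) :
    (-1 : k) • x = -x :=
  neg_one_smul k x

end InducedStructure

set_option maxSynthPendingDepth 5 in
theorem statement7 (k A B : Type) [Field k] [CharZero k]
    [AddCommGroup A] [Module k A] [FiniteDimensional k A]
    [AddCommGroup B] [Module k B] [FiniteDimensional k B]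
    (ast circ : A →ₗ[k] A →ₗ[k] A) (hA : IsPrePoisson ast circ)
    (ϑ θ : A →ₗ[k] A ⊗[k] A) (hϑ : IsZinbielCo ϑ) (hθ : IsPreLieCo θ)
    (hPPco1 : ∀ a : A,
      TensorProduct.map (θ - (tau k A) ∘ₗ θ) (idm k A) (ϑ a)
        = unassoc k A (TensorProduct.map (idm k A) ϑ (θ a))
          - TensorProduct.map (tau k A) (idm k A)
              (unassoc k A (TensorProduct.map (idm k A) θ (ϑ a))))
    (hPPco2 : ∀ a : A,
      TensorProduct.map (ϑ + (tau k A) ∘ₗ ϑ) (idm k A) (θ a)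
        = unassoc k A (TensorProduct.map (idm k A) θ (ϑ a))
          + TensorProduct.map (tau k A) (idm k A)
              (unassoc k A (TensorProduct.map (idm k A) θ (ϑ a))))
    (hZb1 : ∀ a₁ a₂ : A,
      ϑ (ast a₁ a₂) + tau k A (ϑ (ast a₁ a₂))
        = TensorProduct.map (idm k A) (ast.flip a₂) (ϑ a₁)
          + TensorProduct.map (ast a₁) (idm k A) (ϑ a₂)
          + tau k A (TensorProduct.map (idm k A) (ast a₁) (ϑ a₂)))
    (hZb2 : ∀ a₁ a₂ : A,
      ϑ (ast a₁ a₂ + ast a₂ a₁)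
        = TensorProduct.map (ast a₁) (idm k A) (ϑ a₂)
          + TensorProduct.map (idm k A) (ast a₂) (ϑ a₁)
          + TensorProduct.map (idm k A) (ast.flip a₂) (ϑ a₁))
    (hPLb1 : ∀ a₁ a₂ : A,
      (θ (circ a₁ a₂) - tau k A (θ (circ a₁ a₂)))
        - TensorProduct.map (circ a₁) (idm k A) (θ a₂ - tau k A (θ a₂))
        - TensorProduct.map (idm k A) (circ a₁) (θ a₂ - tau k A (θ a₂))
        - TensorProduct.map (idm k A) (circ.flip a₂) (θ a₁)
        + TensorProduct.map (circ.flip a₂) (idm k A) (tau k A (θ a₁)) = 0)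
    (hPLb2 : ∀ a₁ a₂ : A,
      θ (circ a₁ a₂ - circ a₂ a₁)
        - TensorProduct.map (idm k A) (circ.flip a₂ - circ a₂) (θ a₁)
        - TensorProduct.map (idm k A) (circ a₁ - circ.flip a₁) (θ a₂)
        - TensorProduct.map (circ a₁) (idm k A) (θ a₂)
        + TensorProduct.map (circ a₂) (idm k A) (θ a₁) = 0)
    (hPPb1 : ∀ a₁ a₂ : A,
      θ (ast a₁ a₂ + ast a₂ a₁)
        = TensorProduct.map (idm k A) (ast a₂ + ast.flip a₂) (θ a₁)
          + TensorProduct.map (idm k A) (ast a₁ + ast.flip a₁) (θ a₂)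
          - TensorProduct.map (circ a₁) (idm k A) (ϑ a₂)
          - TensorProduct.map (circ a₂) (idm k A) (ϑ a₁))
    (hPPb2 : ∀ a₁ a₂ : A,
      ϑ (circ a₁ a₂ - circ a₂ a₁)
        = TensorProduct.map (ast a₂) (idm k A) (θ a₁)
          - TensorProduct.map (idm k A) (ast a₂ + ast.flip a₂) (θ a₁)
          + TensorProduct.map (circ a₁) (idm k A) (ϑ a₂)
          + TensorProduct.map (idm k A) (circ a₁ - circ.flip a₁) (ϑ a₂))
    (hPPb3 : ∀ a₁ a₂ : A,
      ϑ (circ a₁ a₂) + tau k A (ϑ (circ a₁ a₂))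
        = - TensorProduct.map (idm k A) (ast.flip a₂) (θ a₁)
          - TensorProduct.map (ast.flip a₂) (idm k A) (tau k A (θ a₁))
          + TensorProduct.map (circ a₁) (idm k A) (ϑ a₂ + tau k A (ϑ a₂))
          + TensorProduct.map (idm k A) (circ a₁) (ϑ a₂ + tau k A (ϑ a₂)))
    (hPPb4 : ∀ a₁ a₂ : A,
      θ (ast a₁ a₂) - tau k A (θ (ast a₁ a₂))
        = TensorProduct.map (idm k A) (ast.flip a₂) (θ a₁)
          + TensorProduct.map (idm k A) (ast a₁) (θ a₂ - tau k A (θ a₂))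
          + TensorProduct.map (circ.flip a₂) (idm k A) (tau k A (ϑ a₁))
          - TensorProduct.map (circ a₁) (idm k A) (ϑ a₂ + tau k A (ϑ a₂)))
    (dia : B →ₗ[k] B →ₗ[k] B) (hdia : IsPerm dia)
    (ω : B →ₗ[k] B →ₗ[k] k)
    (hω₁ : ∀ b₁ b₂ : B, ω b₁ b₂ = - ω b₂ b₁)
    (hω₂ : ∀ b₁ : B, (∀ b₂ : B, ω b₁ b₂ = 0) → b₁ = 0)
    (hω₃ : ∀ b₁ b₂ b₃ : B, ω (dia b₁ b₂) b₃ = ω b₁ (dia b₂ b₃ - dia b₃ b₂))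
    (ωh : B ⊗[k] B →ₗ[k] B ⊗[k] B →ₗ[k] k)
    (hωh : ∀ u₁ u₂ v₁ v₂ : B, ωh (u₁ ⊗ₜ[k] u₂) (v₁ ⊗ₜ[k] v₂) = ω u₁ v₁ * ω u₂ v₂)
    (ν : B →ₗ[k] B ⊗[k] B)
    (hν : ∀ b₁ b₂ b₃ : B, ωh (ν b₁) (b₂ ⊗ₜ[k] b₃) = - ω b₁ (dia b₂ b₃))
    (m : A ⊗[k] B →ₗ[k] A ⊗[k] B →ₗ[k] A ⊗[k] B)
    (hm : ∀ (a₁ a₂ : A) (b₁ b₂ : B),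
      m (a₁ ⊗ₜ[k] b₁) (a₂ ⊗ₜ[k] b₂)
        = (ast a₁ a₂) ⊗ₜ[k] (dia b₁ b₂) + (ast a₂ a₁) ⊗ₜ[k] (dia b₂ b₁))
    (br : A ⊗[k] B →ₗ[k] A ⊗[k] B →ₗ[k] A ⊗[k] B)
    (hbr : ∀ (a₁ a₂ : A) (b₁ b₂ : B),
      br (a₁ ⊗ₜ[k] b₁) (a₂ ⊗ₜ[k] b₂)
        = (circ a₁ a₂) ⊗ₜ[k] (dia b₁ b₂) - (circ a₂ a₁) ⊗ₜ[k] (dia b₂ b₁))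
    (Δ : A ⊗[k] B →ₗ[k] (A ⊗[k] B) ⊗[k] (A ⊗[k] B))
    (hΔ : ∀ (a : A) (b : B),
      Δ (a ⊗ₜ[k] b)
        = intch k A (B) ((ϑ a) ⊗ₜ[k] (ν b))
          + tau k (A ⊗[k] B) (intch k A (B) ((ϑ a) ⊗ₜ[k] (ν b))))
    (δ : A ⊗[k] B →ₗ[k] (A ⊗[k] B) ⊗[k] (A ⊗[k] B))
    (hδ : ∀ (a : A) (b : B),
      δ (a ⊗ₜ[k] b)
        = intch k A (B) ((θ a) ⊗ₜ[k] (ν b))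
          - tau k (A ⊗[k] B) (intch k A (B) ((θ a) ⊗ₜ[k] (ν b))))
    :
    IsPoisson m br ∧
    (∀ q : A ⊗[k] B, tau k (A ⊗[k] B) (Δ q) = Δ q) ∧
    (∀ q : A ⊗[k] B,
      TensorProduct.map Δ (idm k (A ⊗[k] B)) (Δ q)
        = unassoc k (A ⊗[k] B) (TensorProduct.map (idm k (A ⊗[k] B)) Δ (Δ q))) ∧
    (∀ q : A ⊗[k] B, tau k (A ⊗[k] B) (δ q) = - δ q) ∧
    (∀ q : A ⊗[k] B,
      unassoc k (A ⊗[k] B) (TensorProduct.map (idm k (A ⊗[k] B)) δ (δ q))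
        - TensorProduct.map (tau k (A ⊗[k] B)) (idm k (A ⊗[k] B))
            (unassoc k (A ⊗[k] B) (TensorProduct.map (idm k (A ⊗[k] B)) δ (δ q)))
        = TensorProduct.map δ (idm k (A ⊗[k] B)) (δ q)) ∧
    (∀ q : A ⊗[k] B,
      unassoc k (A ⊗[k] B) (TensorProduct.map (idm k (A ⊗[k] B)) Δ (δ q))
        = TensorProduct.map δ (idm k (A ⊗[k] B)) (Δ q)
          + TensorProduct.map (tau k (A ⊗[k] B)) (idm k (A ⊗[k] B))
              (unassoc k (A ⊗[k] B) (TensorProduct.map (idm k (A ⊗[k] B)) δ (Δ q)))) ∧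
    (∀ u v : A ⊗[k] B,
      Δ (m u v) = TensorProduct.map (m v) (idm k (A ⊗[k] B)) (Δ u)
        + TensorProduct.map (idm k (A ⊗[k] B)) (m u) (Δ v)) ∧
    (∀ u v : A ⊗[k] B,
      δ (br u v)
        = TensorProduct.map (br u) (idm k (A ⊗[k] B)) (δ v)
          + TensorProduct.map (idm k (A ⊗[k] B)) (br u) (δ v)
          - TensorProduct.map (br v) (idm k (A ⊗[k] B)) (δ u)
          - TensorProduct.map (idm k (A ⊗[k] B)) (br v) (δ u)) ∧
    (∀ u v : A ⊗[k] B,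
      Δ (br u v)
        = TensorProduct.map (br u) (idm k (A ⊗[k] B)) (Δ v)
          + TensorProduct.map (idm k (A ⊗[k] B)) (br u) (Δ v)
          + TensorProduct.map (m v) (idm k (A ⊗[k] B)) (δ u)
          - TensorProduct.map (idm k (A ⊗[k] B)) (m v) (δ u)) ∧
    (∀ u v : A ⊗[k] B,
      δ (m u v)
        = TensorProduct.map (m u) (idm k (A ⊗[k] B)) (δ v)
          + TensorProduct.map (m v) (idm k (A ⊗[k] B)) (δ u)
          + TensorProduct.map (idm k (A ⊗[k] B)) (br u) (Δ v)
          + TensorProduct.map (idm k (A ⊗[k] B)) (br v) (Δ u)) := by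
  have hB : IsQuadraticPerm dia ω ωh ν := ⟨hdia, hω₁, hω₂, hω₃, hωh, hν⟩
  have hΔ' (a : A) (b : B) : Δ (a ⊗ₜ b) = inter k A B (ϑ a) (ν b)
      + (1 : k) • inter k A B (tau k A (ϑ a)) (tau k B (ν b)) := by
    rw [hΔ, one_smul, ← tau_inter]; rfl
  have hδ' (a : A) (b : B) : δ (a ⊗ₜ b) = inter k A B (θ a) (ν b)
      + (-1 : k) • inter k A B (tau k A (θ a)) (tau k B (ν b)) := by
    rw [hδ, neg_one_smul_tensor₂, ← tau_inter, ← sub_eq_add_neg]; rfl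
  have hm' (a : A) (b : B) (a' : A) (b' : B) : m (a ⊗ₜ b) (a' ⊗ₜ b')
      = ast a a' ⊗ₜ dia b b' + (1 : k) • ast.flip a a' ⊗ₜ dia.flip b b' := by
    rw [hm, one_smul]; rfl
  have hbr' (a : A) (b : B) (a' : A) (b' : B) : br (a ⊗ₜ b) (a' ⊗ₜ b')
      = circ a a' ⊗ₜ dia b b' + (-1 : k) • circ.flip a a' ⊗ₜ dia.flip b b' := by
    rw [hbr, neg_one_smul_tensor, ← sub_eq_add_neg]; rfl
  refine ⟨isPoisson_tensor hA hdia hm hbr, fun q => ?_, fun q => ?_, fun q => ?_, fun q => ?_,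
    fun q => ?_, tensor_induction₂ ?_ ?_ ?_ ?_ ?_, tensor_induction₂ ?_ ?_ ?_ ?_ ?_,
    tensor_induction₂ ?_ ?_ ?_ ?_ ?_, tensor_induction₂ ?_ ?_ ?_ ?_ ?_⟩
  · induction q with
    | zero => simp
    | add x y hx hy => simp only [map_add, hx, hy]
    | tmul a b => simp only [hΔ', one_smul, map_add, tau_inter, tau_tau, add_comm]
  · induction q with
    | zero => simp
    | add x y hx hy => simp only [map_add, hx, hy]
    | tmul a b =>
      simp only [hΔ', one_smul, map_add, map_eq_inter₃ hΔ', unassoc_map_eq_inter₃ hΔ', map_id_tau,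
        unassoc_id_map_tau, hB.unassoc_map_coproduct, swap₁₂_cyc, swap₁₂_cycInv,
        hB.swap₁₂_map_coproduct, cyc_cyc, ← hϑ a, swap₁₂_def, swap₁₂_swap₁₂, LinearMap.add_apply]
      abel
  · induction q with
    | zero => simp
    | add x y hx hy => simp only [map_add, hx, hy, neg_add]
    | tmul a b =>
      simp only [hδ', neg_one_smul_tensor₂, map_add, map_neg, tau_inter, tau_tau]
      abel
  · induction q with
    | zero => simp
    | add x y hx hy =>
      linear_combination (norm := (simp only [map_add]; abel)) hx + hy
    | tmul a b =>
      simp only [hδ', neg_one_smul_tensor₂, map_add, map_neg, map_eq_inter₃ hδ',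
        unassoc_map_eq_inter₃ hδ', neg_one_smul_tensor₃, map_id_tau, unassoc_id_map_tau,
        hB.unassoc_map_coproduct, swap₁₂_cyc, swap₁₂_cycInv, hB.swap₁₂_map_coproduct, cyc_cyc,
        swap₁₂_def, swap₁₂_swap₁₂, swap₁₂_inter₃]
      have h := hθ a
      simp only [swap₁₂_def] at h
      linear_combination (norm := (simp only [map_sub, LinearMap.sub_apply]; abel))
        inter₃_congr_left h (TensorProduct.map ν (idm k B) (ν b))
          + inter₃_congr_left (congrArg (cycInv k A) h)
              (cycInv k B (TensorProduct.map ν (idm k B) (ν b)))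
          + inter₃_congr_left (congrArg (cyc k A) h)
              (cyc k B (TensorProduct.map ν (idm k B) (ν b)))
  · induction q with
    | zero => simp
    | add x y hx hy =>
      linear_combination (norm := (simp only [map_add]; abel)) hx + hy
    | tmul a b =>
      simp only [hΔ', hδ', one_smul, neg_one_smul_tensor₂, map_add, map_neg, map_eq_inter₃ hδ',
        unassoc_map_eq_inter₃ hδ', neg_one_smul_tensor₃, unassoc_map_eq_inter₃ hΔ', map_id_tau,
        unassoc_id_map_tau, hB.unassoc_map_coproduct, swap₁₂_cyc, swap₁₂_cycInv,
        hB.swap₁₂_map_coproduct, cyc_cyc, swap₁₂_def, swap₁₂_swap₁₂, swap₁₂_inter₃]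
      have h₁ := hPPco1 a
      have h₂ := hPPco2 a
      simp only [swap₁₂_def, map_sub_idm, map_add_idm, map_tau_comp_idm] at h₁ h₂
      linear_combination (norm := (simp only [map_sub, map_add, LinearMap.sub_apply,
          LinearMap.add_apply, swap₁₂_swap₁₂]; abel))
        - inter₃_congr_left h₁ (TensorProduct.map ν (idm k B) (ν b))
          - inter₃_congr_left (congrArg (fun x => cycInv k A (swap₁₂ k A x)) h₁)
              (cycInv k B (TensorProduct.map ν (idm k B) (ν b)))
          - inter₃_congr_left (congrArg (cyc k A) h₂)
              (cyc k B (TensorProduct.map ν (idm k B) (ν b)))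
  · simp
  · simp
  · intro x y v hx hy
    linear_combination (norm := (simp only [map_add, LinearMap.add_apply,
        TensorProduct.map_add_right]; abel)) hx + hy
  · intro u x y hx hy
    linear_combination (norm := (simp only [map_add, LinearMap.add_apply,
        TensorProduct.map_add_left]; abel)) hx + hy
  · intro a a' b b'
    simp only [hm, hΔ', one_smul, map_add, map_sub, map_left_inter (hm' a' b'),
      map_right_inter (hm' a b), ← tau_map, hB.map_dia_left, hB.map_dia_right, hB.map_flip_left,
      hB.map_flip_right, map_zero, hB.tau_coproduct_dia b b']
    linear_combination (norm := (simp only [map_add, LinearMap.add_apply, tau_tau]; abel))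
      inter_congr_left (congrArg (tau k A) (hZb1 a a')) (ν (dia b b'))
        + inter_congr_left (hZb2 a' a) (ν (dia b' b))
        - inter_congr_left (congrArg (tau k A) (hZb1 a a')) (ν (dia b' b))
        + inter_congr_left (congrArg (tau k A) (hZb2 a a')) (tau k B (ν (dia b' b)))
  · simp
  · simp
  · intro x y v hx hy
    linear_combination (norm := (simp only [map_add, LinearMap.add_apply,
        TensorProduct.map_add_left, TensorProduct.map_add_right]; abel)) hx + hy
  · intro u x y hx hy
    linear_combination (norm := (simp only [map_add, LinearMap.add_apply,
        TensorProduct.map_add_left, TensorProduct.map_add_right]; abel)) hx + hy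
  · intro a a' b b'
    simp only [hbr, hδ', neg_one_smul_tensor₂, map_add, map_sub, map_neg, map_left_inter (hbr' a
      b), map_left_inter (hbr' a' b'), map_right_inter (hbr' a b), map_right_inter (hbr' a' b'), ←
      tau_map, hB.map_dia_left, hB.map_dia_right, hB.map_flip_left, hB.map_flip_right, map_zero,
      hB.tau_coproduct_dia b b']
    linear_combination (norm := (simp only [map_sub, map_add, LinearMap.sub_apply,
        LinearMap.add_apply, map_idm_sub, ← tau_map, map_zero, LinearMap.zero_apply]; abel))
      inter_congr_left (hPLb1 a a') (ν (dia b b'))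
        - inter_congr_left (hPLb1 a a') (ν (dia b' b))
        + inter_congr_left (hPLb2 a a') (ν (dia b' b))
        - inter_congr_left (congrArg (tau k A) (hPLb2 a a')) (tau k B (ν (dia b' b)))
  · simp
  · simp
  · intro x y v hx hy
    linear_combination (norm := (simp only [map_add, LinearMap.add_apply,
        TensorProduct.map_add_left, TensorProduct.map_add_right]; abel)) hx + hy
  · intro u x y hx hy
    linear_combination (norm := (simp only [map_add, LinearMap.add_apply,
        TensorProduct.map_add_left, TensorProduct.map_add_right]; abel)) hx + hy
  · intro a a' b b'
    simp only [hbr, hΔ', hδ', one_smul, neg_one_smul_tensor₂, map_add, map_sub, map_neg,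
      map_left_inter (hm' a' b'), map_right_inter (hm' a' b'), map_left_inter (hbr' a b),
      map_right_inter (hbr' a b), ← tau_map, hB.map_dia_left, hB.map_dia_right, hB.map_flip_left,
      hB.map_flip_right, map_zero, hB.tau_coproduct_dia b b']
    linear_combination (norm := (simp only [map_sub, map_add, map_neg, LinearMap.sub_apply,
        LinearMap.add_apply, LinearMap.neg_apply, map_idm_add, map_idm_sub, ← tau_map]; abel))
      inter_congr_left (hPPb3 a a') (ν (dia b b'))
        - inter_congr_left (hPPb3 a a') (ν (dia b' b))
        + inter_congr_left (hPPb2 a a') (ν (dia b' b))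
        + inter_congr_left (congrArg (tau k A) (hPPb2 a a')) (tau k B (ν (dia b' b)))
  · simp
  · simp
  · intro x y v hx hy
    linear_combination (norm := (simp only [map_add, LinearMap.add_apply,
        TensorProduct.map_add_left, TensorProduct.map_add_right]; abel)) hx + hy
  · intro u x y hx hy
    linear_combination (norm := (simp only [map_add, LinearMap.add_apply,
        TensorProduct.map_add_left, TensorProduct.map_add_right]; abel)) hx + hy
  · intro a a' b b'
    simp only [hm, hΔ', hδ', one_smul, neg_one_smul_tensor₂, map_add, map_sub, map_neg,
      map_left_inter (hm' a b), map_left_inter (hm' a' b'), map_right_inter (hbr' a b),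
      map_right_inter (hbr' a' b'), ← tau_map, hB.map_dia_left, hB.map_dia_right,
      hB.map_flip_left, hB.map_flip_right, map_zero, hB.tau_coproduct_dia b b']
    linear_combination (norm := (simp only [map_sub, map_add, LinearMap.sub_apply,
        LinearMap.add_apply, map_idm_add, map_idm_sub, ← tau_map, tau_tau]; abel))
      - inter_congr_left (congrArg (tau k A) (hPPb4 a a')) (ν (dia b b'))
        + inter_congr_left (congrArg (tau k A) (hPPb4 a a')) (ν (dia b' b))
        + inter_congr_left (hPPb2 a a') (ν (dia b' b))
        + inter_congr_left (hPPb2 a' a) (ν (dia b' b))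
        + inter_congr_left (hPPb1 a a') (ν (dia b' b))
        - inter_congr_left (congrArg (tau k A) (hPPb1 a a')) (tau k B (ν (dia b' b)))
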